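/- arXiv:0707.4304 — 4 statements merged into one kernel-verified Lean document; each statement's English description precedes it below -/
import Mathlib

section
/- Let N ≥ 1 and let L : Fin N → Set (ℝ × ℝ) be a family of pairwise distinct affine lines in the plane. For each index i, let e i be the number of connected components of L i \ (⋃ j ≠ i, L j) with the subspace topology. Then ∑ i, e i ≤ N². -/
/-- An affine line in the plane: a set of the form `{a + t • v : t ∈ ℝ}` with `v ≠ 0`. -/
def IsAffineLine (L : Set (ℝ × ℝ)) : Prop :=
  ∃ a v : ℝ × ℝ, v ≠ 0 ∧ L = {p | ∃ t : ℝ, p = a + t • v}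

/-- An affine line is determined by any two distinct points on it. -/
lemma IsAffineLine.eq_of_mem {M : Set (ℝ × ℝ)} (hM : IsAffineLine M) {p q : ℝ × ℝ}
    (hp : p ∈ M) (hq : q ∈ M) (hpq : p ≠ q) :
    M = {x | ∃ t : ℝ, x = p + t • (q - p)} := by
  obtain ⟨a, v, -, rfl⟩ := hM
  obtain ⟨s, rfl⟩ := hp
  obtain ⟨t, rfl⟩ := hq
  have hst : t - s ≠ 0 := fun h => hpq (by rw [sub_eq_zero.mp h])
  ext x
  constructor
  · rintro ⟨u, rfl⟩
    refine ⟨(u - s) / (t - s), ?_⟩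
    rw [add_sub_add_left_eq_sub, ← sub_smul, smul_smul, div_mul_cancel₀ _ hst]
    module
  · rintro ⟨u, rfl⟩
    exact ⟨s + u * (t - s), by module⟩

/-- If a continuous curve meets each of finitely many sets at no more than one parameter, then the
part of the curve outside these sets has at most one more component than there are sets. -/
lemma card_connectedComponents_range_diff_le {X ι : Type*} [TopologicalSpace X] (F : Finset ι)
    (M : ι → Set X) (φ : ℝ → X) (hφ : Continuous φ) (τ : ι → ℝ)
    (hτ : ∀ j ∈ F, ∀ t, φ t ∈ M j → t = τ j) :
    Nat.card (ConnectedComponents ↥(Set.range φ \ ⋃ j ∈ F, M j)) ≤ F.card + 1 := by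
  classical
  set Y := Set.range φ \ ⋃ j ∈ F, M j with hY
  have hmem : ∀ x : Y, ∀ j ∈ F, (x : X) ∉ M j := fun x j hj hx =>
    x.2.2 (Set.mem_biUnion hj hx)
  choose param hparam using fun x : Y => x.2.1
  let count : Y → ℕ := fun x => (F.filter fun j => τ j < param x).card
  have key : ∀ x y : Y, param x ≤ param y → count x = count y →
      (x : ConnectedComponents Y) = y := by
    intro x y hxy hcount
    have hsub : (F.filter fun j => τ j < param x) ⊆ F.filter fun j => τ j < param y :=
      Finset.monotone_filter_right _ fun j _ hj => lt_of_lt_of_le hj hxy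
    have heq := Finset.eq_of_subset_of_card_le hsub hcount.ge
    have havoid : ∀ u : Set.Icc (param x) (param y), φ u ∈ Y := by
      rintro ⟨u, hxu, huy⟩
      refine ⟨⟨u, rfl⟩, ?_⟩
      simp only [Set.mem_iUnion, not_exists]
      intro j hj hu
      obtain rfl := hτ j hj u hu
      have hlt : τ j < param y := lt_of_le_of_ne huy fun h =>
        hmem y j hj (by rwa [← hparam y, ← h])
      have hj' : j ∈ F.filter fun j => τ j < param x :=
        heq ▸ Finset.mem_filter.mpr ⟨hj, hlt⟩
      exact absurd (Finset.mem_filter.mp hj').2 hxu.not_gt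
    let γ : Set.Icc (param x) (param y) → Y := fun u => ⟨φ u, havoid u⟩
    have hγ : Continuous γ := (hφ.comp continuous_subtype_val).subtype_mk _
    have : PreconnectedSpace (Set.Icc (param x) (param y)) :=
      Subtype.preconnectedSpace isPreconnected_Icc
    rw [ConnectedComponents.coe_eq_coe']
    exact (isPreconnected_range hγ).subset_connectedComponent
      ⟨⟨param y, hxy, le_rfl⟩, Subtype.ext (hparam y)⟩
      ⟨⟨param x, le_rfl, hxy⟩, Subtype.ext (hparam x)⟩
  choose rep hrep using ConnectedComponents.surjective_coe (α := Y)
  let f : ConnectedComponents Y → Fin (F.card + 1) := fun c =>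
    ⟨count (rep c), Nat.lt_succ_of_le (Finset.card_filter_le _ _)⟩
  have hf : Function.Injective f := by
    intro c d hcd
    have hcount : count (rep c) = count (rep d) := congrArg Fin.val hcd
    rw [← hrep c, ← hrep d]
    rcases le_total (param (rep c)) (param (rep d)) with h | h
    · exact key _ _ h hcount
    · exact (key _ _ h hcount.symm).symm
  simpa using Nat.card_le_card_of_injective f hf

theorem stmt_5 (N : ℕ) (hN : 1 ≤ N) (L : Fin N → Set (ℝ × ℝ))
    (hline : ∀ i, IsAffineLine (L i)) (hdist : Function.Injective L) :
    ∑ i : Fin N,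
      Nat.card (ConnectedComponents ↥(L i \ ⋃ (j) (_ : j ≠ i), L j)) ≤ N ^ 2 := by
  have hcard : ∀ i : Fin N,
      Nat.card (ConnectedComponents ↥(L i \ ⋃ (j) (_ : j ≠ i), L j)) ≤ N := by
    intro i
    obtain ⟨a, v, hv, hL⟩ := hline i
    let φ : ℝ → ℝ × ℝ := fun t => a + t • v
    have hφ : Continuous φ := by fun_prop
    have hφ_inj : Function.Injective φ := fun s t h =>
      smul_left_injective ℝ hv (add_left_cancel h)
    have hrange : L i = Set.range φ := by
      rw [hL]
      ext p
      simp [φ, eq_comm]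
    have hτ : ∀ j, ∃ τ : ℝ, j ≠ i → ∀ t, φ t ∈ L j → t = τ := by
      intro j
      by_cases h : ∃ τ, φ τ ∈ L j
      · obtain ⟨τ, hτ⟩ := h
        refine ⟨τ, fun hji t ht => ?_⟩
        by_contra hne
        have hne' : φ t ≠ φ τ := hφ_inj.ne hne
        refine hji (hdist ?_)
        rw [(hline j).eq_of_mem ht hτ hne',
          (hline i).eq_of_mem (hrange ▸ ⟨t, rfl⟩) (hrange ▸ ⟨τ, rfl⟩) hne']
      · exact ⟨0, fun _ t ht => absurd ⟨t, ht⟩ h⟩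
    choose τ hτ using hτ
    have hbound := card_connectedComponents_range_diff_le (Finset.univ.erase i) L φ hφ τ
      fun j hj => hτ j (Finset.ne_of_mem_erase hj)
    have hsets : (L i \ ⋃ (j) (_ : j ≠ i), L j) =
        Set.range φ \ ⋃ j ∈ Finset.univ.erase i, L j := by
      rw [← hrange]
      simp
    rw [hsets]
    rw [Finset.card_erase_of_mem (Finset.mem_univ i), Finset.card_univ, Fintype.card_fin,
      Nat.sub_add_cancel hN] at hbound
    exact hbound
  calc _ ≤ ∑ _i : Fin N, N := Finset.sum_le_sum fun i _ => hcard i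
    _ = N ^ 2 := by simp [sq]
end

section
/- Let N ≥ 1 and let L : Fin N → Set (ℝ × ℝ) be a family of affine lines in the plane. Then the complement (ℝ × ℝ) \ (⋃ i, L i) has at most N²/2 + N/2 + 1 connected components; precisely, if F denotes the number of its connected components, then 2·F ≤ N² + N + 2. -/
/-- The signed area form `v₁ (p₂ - a₂) - v₂ (p₁ - a₁)`, which vanishes exactly on the line through
`a` with direction `v`. -/
def lineForm (a v p : ℝ × ℝ) : ℝ := v.1 * (p.2 - a.2) - v.2 * (p.1 - a.1)

theorem lineForm_eq_zero_iff {a v : ℝ × ℝ} (hv : v ≠ 0) (p : ℝ × ℝ) :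
    lineForm a v p = 0 ↔ ∃ t : ℝ, p = a + t • v := by
  constructor
  · intro h
    have hpos : v.1 ^ 2 + v.2 ^ 2 ≠ 0 := fun h0 => hv <| Prod.ext
      (by simp only [Prod.fst_zero]; nlinarith [sq_nonneg v.1, sq_nonneg v.2])
      (by simp only [Prod.snd_zero]; nlinarith [sq_nonneg v.1, sq_nonneg v.2])
    unfold lineForm at h
    refine ⟨((p.1 - a.1) * v.1 + (p.2 - a.2) * v.2) / (v.1 ^ 2 + v.2 ^ 2), Prod.ext ?_ ?_⟩
    · simp only [Prod.fst_add, Prod.smul_fst, smul_eq_mul]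
      field_simp
      linear_combination (-v.2) * h
    · simp only [Prod.snd_add, Prod.smul_snd, smul_eq_mul]
      field_simp
      linear_combination v.1 * h
  · rintro ⟨t, rfl⟩
    simp only [lineForm, Prod.fst_add, Prod.smul_fst, Prod.snd_add, Prod.smul_snd, smul_eq_mul]
    ring

/-- If two points lie strictly on the same side of a line, so does the segment joining them. -/
theorem lineForm_ne_zero_of_mem_segment {a v p q z : ℝ × ℝ} (hp : lineForm a v p ≠ 0)
    (hq : lineForm a v q ≠ 0) (h : 0 < lineForm a v p ↔ 0 < lineForm a v q)
    (hz : z ∈ segment ℝ p q) : lineForm a v z ≠ 0 := by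
  obtain ⟨s, t, hs, ht, hst, rfl⟩ := hz
  have key : lineForm a v (s • p + t • q) = s * lineForm a v p + t * lineForm a v q := by
    simp only [lineForm, Prod.fst_add, Prod.smul_fst, Prod.snd_add, Prod.smul_snd, smul_eq_mul]
    linear_combination (a.1 * v.2 - a.2 * v.1) * hst.symm
  rw [key]
  obtain rfl : t = 1 - s := by linarith
  rcases lt_or_gt_of_ne hp with h1 | h1
  · have h2 : lineForm a v q < 0 := lt_of_le_of_ne (not_lt.1 (mt h.2 h1.not_gt)) hq
    rcases hs.eq_or_lt with rfl | hs
    · simpa using hq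
    · nlinarith [mul_neg_of_pos_of_neg hs h1, mul_nonpos_of_nonneg_of_nonpos ht h2.le]
  · have h2 := h.1 h1
    rcases hs.eq_or_lt with rfl | hs
    · simpa using hq
    · nlinarith [mul_pos hs h1, mul_nonneg ht h2.le]

section SignPatterns

open Classical in
/-- The indices of the lines which have `p` on their positive side. -/
noncomputable def positiveSide {ι : Type*} [Fintype ι] (a v : ι → ℝ × ℝ) (p : ℝ × ℝ) : Finset ι :=
  {i | 0 < lineForm (a i) (v i) p}

theorem mem_positiveSide {ι : Type*} [Fintype ι] {a v : ι → ℝ × ℝ} {p : ℝ × ℝ} {i : ι} :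
    i ∈ positiveSide a v p ↔ 0 < lineForm (a i) (v i) p := by
  simp [positiveSide]

open Classical in
/-- The sign patterns realised by points lying on none of the lines. -/
noncomputable def signPatterns {ι : Type*} [Fintype ι] (a v : ι → ℝ × ℝ) : Finset (Finset ι) :=
  {s | ∃ p, (∀ i, lineForm (a i) (v i) p ≠ 0) ∧ positiveSide a v p = s}

theorem mem_signPatterns {ι : Type*} [Fintype ι] {a v : ι → ℝ × ℝ} {s : Finset ι} :
    s ∈ signPatterns a v ↔
      ∃ p, (∀ i, lineForm (a i) (v i) p ≠ 0) ∧ positiveSide a v p = s := by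
  simp [signPatterns]

/-- The sign patterns of lines in the plane shatter no set of three lines: a linear relation between
three direction vectors forbids one of the sign patterns. -/
theorem card_le_two_of_shatters_signPatterns {ι : Type*} [Fintype ι] [DecidableEq ι]
    {a v : ι → ℝ × ℝ} {s : Finset ι} (hs : (signPatterns a v).Shatters s) : s.card ≤ 2 := by
  by_contra! hcard
  have hdep : ¬ LinearIndependent ℝ (fun i : s => v i) := fun h => by
    have := h.fintype_card_le_finrank
    simp at this
    omega
  obtain ⟨w, hw, i₀, hi₀⟩ := Fintype.not_linearIndependent_iff.1 hdep
  have realise (P : s → Prop) : ∃ p, (∀ i, lineForm (a i) (v i) p ≠ 0) ∧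
      ∀ i : s, 0 < lineForm (a i) (v i) p ↔ P i := by
    classical
    obtain ⟨u, hu, hsu⟩ := hs (t := s.filter fun i => ∃ h : i ∈ s, P ⟨i, h⟩)
      (Finset.filter_subset _ _)
    obtain ⟨p, hp, rfl⟩ := mem_signPatterns.1 hu
    refine ⟨p, hp, fun i => ?_⟩
    have := Finset.ext_iff.1 hsu i
    simpa [mem_positiveSide] using this
  obtain ⟨p, hp, hpw⟩ := realise fun i => 0 < w i
  obtain ⟨q, hq, hqw⟩ := realise fun i => w i < 0
  have hpos : ∀ i : s, w i ≠ 0 →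
      0 < w i * (lineForm (a i) (v i) p - lineForm (a i) (v i) q) := fun i hi => by
    rcases lt_or_gt_of_ne hi with h | h
    · have h1 : ¬ 0 < lineForm (a i) (v i) p := fun h' => h.not_gt ((hpw i).1 h')
      have h2 := (hqw i).2 h
      exact mul_pos_of_neg_of_neg h (by linarith)
    · have h1 := (hpw i).2 h
      have h2 : ¬ 0 < lineForm (a i) (v i) q := fun h' => h.not_gt ((hqw i).1 h')
      exact mul_pos h (by linarith)
  have hsum : 0 < ∑ i : s, w i * (lineForm (a i) (v i) p - lineForm (a i) (v i) q) := by
    refine Finset.sum_pos' (fun i _ => ?_) ⟨i₀, Finset.mem_univ _, hpos i₀ hi₀⟩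
    by_cases hi : w i = 0
    · simp [hi]
    · exact (hpos i hi).le
  have h1 : ∑ i, w i * (v i).1 = 0 := by
    simpa [Prod.fst_sum] using congrArg Prod.fst hw
  have h2 : ∑ i, w i * (v i).2 = 0 := by
    simpa [Prod.snd_sum] using congrArg Prod.snd hw
  have hzero : ∑ i : s, w i * (lineForm (a i) (v i) p - lineForm (a i) (v i) q) =
      (∑ i, w i * (v i).1) * (p.2 - q.2) - (∑ i, w i * (v i).2) * (p.1 - q.1) := by
    rw [Finset.sum_mul, Finset.sum_mul, ← Finset.sum_sub_distrib]
    refine Finset.sum_congr rfl fun i _ => ?_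
    unfold lineForm
    ring
  rw [h1, h2] at hzero
  linarith

/-- By the Sauer–Shelah lemma, `n` lines realise at most `n² / 2 + n / 2 + 1` sign patterns. -/
theorem two_mul_card_signPatterns_le {ι : Type*} [Fintype ι] (a v : ι → ℝ × ℝ) :
    2 * (signPatterns a v).card ≤ Fintype.card ι ^ 2 + Fintype.card ι + 2 := by
  classical
  have hdim : (signPatterns a v).vcDim ≤ 2 := Finset.sup_le fun s hs =>
    card_le_two_of_shatters_signPatterns (Finset.mem_shatterer.1 hs)
  have hle : (signPatterns a v).card ≤ ∑ k ∈ Finset.Iic 2, (Fintype.card ι).choose k :=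
    (Finset.card_le_card_shatterer _).trans <| Finset.card_shatterer_le_sum_vcDim.trans <|
      Finset.sum_le_sum_of_subset (Finset.Iic_subset_Iic.2 hdim)
  have hsum : ∑ k ∈ Finset.Iic 2, (Fintype.card ι).choose k =
      1 + Fintype.card ι + (Fintype.card ι).choose 2 := by
    rw [show Finset.Iic 2 = Finset.range 3 from rfl]
    simp [Finset.sum_range_succ]
  generalize Fintype.card ι = n at *
  have hchoose : 2 * n.choose 2 + n = n ^ 2 := by
    cases n with
    | zero => rfl
    | succ k =>
      rw [Nat.choose_two_right, Nat.mul_div_cancel' (Nat.even_mul_pred_self _).two_dvd]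
      simp only [Nat.add_sub_cancel]
      ring
  omega

end SignPatterns

theorem stmt_6 (N : ℕ) (hN : 1 ≤ N) (L : Fin N → Set (ℝ × ℝ))
    (hline : ∀ i, IsAffineLine (L i)) :
    2 * Nat.card (ConnectedComponents ↥((⋃ i, L i)ᶜ)) ≤ N ^ 2 + N + 2 := by
  choose a v hv hL using hline
  have hmem (p : ℝ × ℝ) : p ∈ (⋃ i, L i)ᶜ ↔ ∀ i, lineForm (a i) (v i) p ≠ 0 := by
    simp only [Set.mem_compl_iff, Set.mem_iUnion, not_exists, hL, Set.mem_ofPred_eq, ne_eq,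
      lineForm_eq_zero_iff (hv _)]
  have hsame (x y : ↥((⋃ i, L i)ᶜ)) (h : positiveSide a v x = positiveSide a v y) :
      (x : ConnectedComponents ↥((⋃ i, L i)ᶜ)) = y := by
    have hsub : segment ℝ (x : ℝ × ℝ) y ⊆ (⋃ i, L i)ᶜ := fun z hz => (hmem z).2 fun i =>
      lineForm_ne_zero_of_mem_segment ((hmem x).1 x.2 i) ((hmem y).1 y.2 i)
        (by simpa only [mem_positiveSide] using Finset.ext_iff.1 h i) hz
    rw [ConnectedComponents.coe_eq_coe']
    have hconn : IsPreconnected ((↑) ⁻¹' segment ℝ (x : ℝ × ℝ) y : Set ↥((⋃ i, L i)ᶜ)) := by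
      rw [← Topology.IsInducing.subtypeVal.isPreconnected_image,
        Subtype.image_preimage_coe, Set.inter_eq_right.2 hsub]
      exact (convex_segment _ _).isPreconnected
    exact hconn.subset_connectedComponent (right_mem_segment ℝ _ _) (left_mem_segment ℝ _ _)
  have hcard : Nat.card (ConnectedComponents ↥((⋃ i, L i)ᶜ)) ≤ (signPatterns a v).card := by
    choose r hr using ConnectedComponents.surjective_coe (α := ↥((⋃ i, L i)ᶜ))
    let f (c : ConnectedComponents ↥((⋃ i, L i)ᶜ)) : signPatterns a v :=
      ⟨positiveSide a v (r c), mem_signPatterns.2 ⟨r c, (hmem _).1 (r c).2, rfl⟩⟩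
    have hf : Function.Injective f := fun c d hcd => by
      rw [← hr c, ← hr d]
      exact hsame _ _ (congrArg Subtype.val hcd)
    simpa using Nat.card_le_card_of_injective f hf
  have := two_mul_card_signPatterns_le a v
  rw [Fintype.card_fin] at this
  omega
end

section
/- Let A = s₁ ∪ … ∪ s_l be a union of l nondegenerate closed segments in ℝ × ℝ (each s_m is the convex hull of two distinct points). Then the set of affine lines ℓ ⊆ ℝ × ℝ such that ℓ ∩ A is infinite has at most l elements. -/
/-- An affine line is determined by any two of its distinct points. -/
theorem IsAffineLine.eq_of_mem_s10 {L : Set (ℝ × ℝ)} (hL : IsAffineLine L) {x y : ℝ × ℝ}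
    (hx : x ∈ L) (hy : y ∈ L) (hxy : x ≠ y) :
    L = {z | ∃ t : ℝ, z = x + t • (y - x)} := by
  obtain ⟨a, v, -, rfl⟩ := hL
  obtain ⟨s, rfl⟩ := hx
  obtain ⟨r, rfl⟩ := hy
  have hsr : r - s ≠ 0 := by
    intro h
    exact hxy (by rw [sub_eq_zero.mp h])
  ext z
  constructor
  · rintro ⟨t, rfl⟩
    refine ⟨(t - s) / (r - s), ?_⟩
    rw [add_sub_add_left_eq_sub, ← sub_smul, smul_smul, div_mul_cancel₀ _ hsr]
    module
  · rintro ⟨t, rfl⟩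
    exact ⟨s + t * (r - s), by module⟩

theorem segment_subset_affineLine (p q : ℝ × ℝ) :
    segment ℝ p q ⊆ {z | ∃ t : ℝ, z = p + t • (q - p)} := by
  rw [segment_eq_image']
  rintro _ ⟨t, -, rfl⟩
  exact ⟨t, rfl⟩

/-- A line meeting a nondegenerate segment in infinitely many points is the line it spans. -/
theorem IsAffineLine.eq_of_infinite_inter_segment {L : Set (ℝ × ℝ)} (hL : IsAffineLine L)
    {p q : ℝ × ℝ} (hpq : p ≠ q) (h : (L ∩ segment ℝ p q).Infinite) :
    {z | ∃ t : ℝ, z = p + t • (q - p)} = L := by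
  obtain ⟨x, hx, y, hy, hxy⟩ := h.nontrivial
  have hM : IsAffineLine {z | ∃ t : ℝ, z = p + t • (q - p)} :=
    ⟨p, q - p, sub_ne_zero.mpr hpq.symm, rfl⟩
  rw [hL.eq_of_mem_s10 hx.1 hy.1 hxy]
  exact hM.eq_of_mem_s10 (segment_subset_affineLine p q hx.2) (segment_subset_affineLine p q hy.2) hxy

theorem stmt_10 (l : ℕ) (p q : Fin l → ℝ × ℝ) (hpq : ∀ m, p m ≠ q m) :
    {ℓ : Set (ℝ × ℝ) |
        IsAffineLine ℓ ∧ (ℓ ∩ ⋃ m, segment ℝ (p m) (q m)).Infinite}.Finite ∧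
      Nat.card {ℓ : Set (ℝ × ℝ) |
        IsAffineLine ℓ ∧ (ℓ ∩ ⋃ m, segment ℝ (p m) (q m)).Infinite} ≤ l := by
  have hsub : {ℓ : Set (ℝ × ℝ) |
      IsAffineLine ℓ ∧ (ℓ ∩ ⋃ m, segment ℝ (p m) (q m)).Infinite} ⊆
      Set.range fun m => {z | ∃ t : ℝ, z = p m + t • (q m - p m)} := by
    rintro L ⟨hL, hinf⟩
    have hm : ∃ m, (L ∩ segment ℝ (p m) (q m)).Infinite := by
      by_contra! hfin
      rw [Set.inter_iUnion] at hinf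
      exact hinf (Set.finite_iUnion fun m => by simpa using hfin m)
    obtain ⟨m, hm⟩ := hm
    exact ⟨m, hL.eq_of_infinite_inter_segment (hpq m) hm⟩
  refine ⟨(Set.finite_range _).subset hsub, (Nat.card_mono (Set.finite_range _) hsub).trans ?_⟩
  exact (Finite.card_range_le _).trans_eq (Nat.card_fin l)
end

section
/- Let p₀, p₁, …, p_l be points in ℝ × ℝ with p₀ ≠ p₁, p_{l−1} ≠ p_l, and with consecutive points distinct, and let P = [p₀,p₁] ∪ [p₁,p₂] ∪ … ∪ [p_{l−1},p_l] be the associated polyline (a union of l nondegenerate closed segments). Define the carrier set of P as the set of affine lines ℓ ⊆ ℝ × ℝ with ℓ ∩ P infinite, together with the line through p₀ perpendicular to the segment [p₀,p₁] and the line through p_l perpendicular to the segment [p_{l−1},p_l]. Then the carrier set of P has at most l + 2 elements. -/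
/-- The line through `a` perpendicular (for the standard inner product on `ℝ²`)
to the segment `[p, q]`. -/
def IsPerpLineThrough (a p q : ℝ × ℝ) (ℓ : Set (ℝ × ℝ)) : Prop :=
  ∃ w : ℝ × ℝ, w ≠ 0 ∧ w.1 * (q - p).1 + w.2 * (q - p).2 = 0 ∧
    ℓ = {x | ∃ t : ℝ, x = a + t • w}

/-- The line through `x` with direction `v`. -/
def lineThrough (x v : ℝ × ℝ) : Set (ℝ × ℝ) := {z | ∃ t : ℝ, z = x + t • v}

theorem lineThrough_eq_of_mem {a v x y : ℝ × ℝ} (hx : x ∈ lineThrough a v)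
    (hy : y ∈ lineThrough a v) (hxy : x ≠ y) : lineThrough a v = lineThrough x (y - x) := by
  obtain ⟨s, rfl⟩ := hx
  obtain ⟨t, rfl⟩ := hy
  have hst : t - s ≠ 0 := fun h => hxy (by rw [sub_eq_zero.mp h])
  ext z
  constructor
  · rintro ⟨r, rfl⟩
    refine ⟨(r - s) / (t - s), ?_⟩
    ext <;> simp <;> field_simp <;> ring
  · rintro ⟨r, rfl⟩
    refine ⟨s + r * (t - s), ?_⟩
    ext <;> simp <;> ring

theorem lineThrough_eq_lineThrough {a v b w x y : ℝ × ℝ} (hxa : x ∈ lineThrough a v)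
    (hya : y ∈ lineThrough a v) (hxb : x ∈ lineThrough b w) (hyb : y ∈ lineThrough b w)
    (hxy : x ≠ y) : lineThrough a v = lineThrough b w :=
  (lineThrough_eq_of_mem hxa hya hxy).trans (lineThrough_eq_of_mem hxb hyb hxy).symm

theorem segment_subset_lineThrough (p q : ℝ × ℝ) : segment ℝ p q ⊆ lineThrough p (q - p) := by
  rw [segment_eq_image']
  rintro _ ⟨t, -, rfl⟩
  exact ⟨t, rfl⟩

theorem IsAffineLine.eq_lineThrough_of_infinite_inter_segment {L : Set (ℝ × ℝ)}
    (hL : IsAffineLine L) {p q : ℝ × ℝ} (h : (L ∩ segment ℝ p q).Infinite) :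
    L = lineThrough p (q - p) := by
  obtain ⟨a, v, -, rfl⟩ := hL
  obtain ⟨x, hx, y, hy, hxy⟩ := h.nontrivial
  exact lineThrough_eq_lineThrough hx.1 hy.1 (segment_subset_lineThrough p q hx.2)
    (segment_subset_lineThrough p q hy.2) hxy

theorem IsPerpLineThrough.eq_lineThrough {a p q : ℝ × ℝ} {L : Set (ℝ × ℝ)}
    (hL : IsPerpLineThrough a p q L) (hpq : p ≠ q) :
    L = lineThrough a (-(q - p).2, (q - p).1) := by
  obtain ⟨w, hw, horth, rfl⟩ := hL
  have hd : q - p ≠ 0 := sub_ne_zero.mpr hpq.symm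
  generalize q - p = d at horth hd ⊢
  have hd' : d.1 ^ 2 + d.2 ^ 2 ≠ 0 := by
    intro h
    exact hd (Prod.ext (by simp; nlinarith [sq_nonneg d.1, sq_nonneg d.2])
      (by simp; nlinarith [sq_nonneg d.1, sq_nonneg d.2]))
  refine lineThrough_eq_lineThrough (x := a) (y := a + w) ⟨0, by simp⟩ ⟨1, by simp⟩ ⟨0, by simp⟩
    ⟨(w.2 * d.1 - w.1 * d.2) / (d.1 ^ 2 + d.2 ^ 2), ?_⟩ (by simpa using hw)
  ext
  · simp only [Prod.fst_add, Prod.smul_fst, smul_eq_mul]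
    field_simp
    linear_combination d.1 * horth
  · simp only [Prod.snd_add, Prod.smul_snd, smul_eq_mul]
    field_simp
    linear_combination d.2 * horth

theorem stmt_11 (l : ℕ) (hl : 1 ≤ l) (p : Fin (l + 1) → ℝ × ℝ)
    (h01 : p 0 ≠ p 1)
    (hlast : p ⟨l - 1, by omega⟩ ≠ p (Fin.last l))
    (hconsec : ∀ m : Fin l, p m.castSucc ≠ p m.succ) :
    ({ℓ : Set (ℝ × ℝ) | IsAffineLine ℓ ∧
        (ℓ ∩ ⋃ m : Fin l, segment ℝ (p m.castSucc) (p m.succ)).Infinite} ∪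
      {ℓ : Set (ℝ × ℝ) | IsPerpLineThrough (p 0) (p 0) (p 1) ℓ} ∪
      {ℓ : Set (ℝ × ℝ) |
        IsPerpLineThrough (p (Fin.last l)) (p ⟨l - 1, by omega⟩) (p (Fin.last l)) ℓ}).Finite ∧
    Nat.card
      ↥({ℓ : Set (ℝ × ℝ) | IsAffineLine ℓ ∧
          (ℓ ∩ ⋃ m : Fin l, segment ℝ (p m.castSucc) (p m.succ)).Infinite} ∪
        {ℓ : Set (ℝ × ℝ) | IsPerpLineThrough (p 0) (p 0) (p 1) ℓ} ∪
        {ℓ : Set (ℝ × ℝ) |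
          IsPerpLineThrough (p (Fin.last l)) (p ⟨l - 1, by omega⟩) (p (Fin.last l)) ℓ}) ≤
      l + 2 := by
  set f : Fin l → Set (ℝ × ℝ) := fun m => lineThrough (p m.castSucc) (p m.succ - p m.castSucc)
  set A := lineThrough (p 0) (-(p 1 - p 0).2, (p 1 - p 0).1)
  set r : ℝ × ℝ := p (Fin.last l) - p ⟨l - 1, by omega⟩
  set B := lineThrough (p (Fin.last l)) (-r.2, r.1)
  have hfin : (Set.range f ∪ {A} ∪ {B}).Finite :=
    ((Set.finite_range f).union (Set.finite_singleton A)).union (Set.finite_singleton B)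
  have hcard : (Set.range f ∪ {A} ∪ {B}).ncard ≤ l + 2 := by
    have hf : (Set.range f).ncard ≤ l := by
      simpa [Set.image_univ] using Set.ncard_image_le (f := f) (Set.finite_univ)
    have h₁ := Set.ncard_union_le (Set.range f ∪ {A}) {B}
    have h₂ := Set.ncard_union_le (Set.range f) {A}
    rw [Set.ncard_singleton] at h₁ h₂
    omega
  refine (fun hsub => ⟨hfin.subset hsub,
    (Nat.card_coe_set_eq _).le.trans ((Set.ncard_le_ncard hsub hfin).trans hcard)⟩) ?_
  refine Set.union_subset_union (Set.union_subset_union ?_ ?_) ?_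
  · rintro L ⟨hL, hinf⟩
    rw [Set.inter_iUnion] at hinf
    obtain ⟨m, hm⟩ : ∃ m : Fin l,
        (L ∩ segment ℝ (p m.castSucc) (p m.succ)).Infinite := by
      by_contra! h
      exact hinf (Set.finite_iUnion h)
    exact ⟨m, (hL.eq_lineThrough_of_infinite_inter_segment hm).symm⟩
  · exact fun L hL => hL.eq_lineThrough h01
  · exact fun L hL => hL.eq_lineThrough hlast
end
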